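/- Let m, d be integers with m ≥ d ≥ 2, N = m^d, and let θ ∈ [0, π/2]. Then the expected squared L₂-discrepancy of the stratified sample from the partition Ω*∼(θ) is at most that of the stratified sample from the grid partition Ω*_| (jittered sampling): 𝔼L₂²(P_{Ω*∼(θ)}) ≤ 𝔼L₂²(P_{Ω*_|}). -/

import Mathlib

open MeasureTheory Real Set

noncomputable section

/-- The unit cube `[0,1]^d`. -/
def unitCube (d : ℕ) : Set (Fin d → ℝ) := Set.univ.pi fun _ => Set.Icc (0 : ℝ) 1

/-- The anchored half-open box `[0, z) = ∏ⱼ [0, zⱼ)`. -/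
def lowerBox {d : ℕ} (z : Fin d → ℝ) : Set (Fin d → ℝ) := {y | ∀ i, 0 ≤ y i ∧ y i < z i}

/-- The squared `L₂`-discrepancy of a point configuration `P` in `[0,1]^d`:
`∫_{[0,1]^d} (λ([0,z)) - (1/N) #{i : P i ∈ [0,z)})² dz`. -/
def L2sq {d : ℕ} {ι : Type} [Fintype ι] (P : ι → Fin d → ℝ) : ℝ :=
  ∫ z in unitCube d,
    ((volume (lowerBox z)).toReal
      - (Fintype.card ι : ℝ)⁻¹ * (Nat.card {i // P i ∈ lowerBox z} : ℝ)) ^ 2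

/-- The joint distribution of the stratified sample associated to a partition `Ω`:
independent points, the `i`-th uniformly distributed on `Ω i`. -/
def stratified {d : ℕ} {ι : Type} [Fintype ι] (Ω : ι → Set (Fin d → ℝ)) :
    Measure (ι → Fin d → ℝ) :=
  Measure.pi fun i => ProbabilityTheory.cond volume (Ω i)

/-- Expected squared `L₂`-discrepancy of the stratified sample from the partition `Ω`. -/
def expL2sq {d : ℕ} {ι : Type} [Fintype ι] (Ω : ι → Set (Fin d → ℝ)) : ℝ :=
  ∫ P, L2sq P ∂(stratified Ω)

/-- The rectangle `I = [0,2] × [0,1] ⊆ ℝ²`. -/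
def I2 : Set (ℝ × ℝ) := Set.Icc (0 : ℝ) 2 ×ˢ Set.Icc (0 : ℝ) 1

open scoped Classical in
/-- The cell `Ω₁(θ)` of the one-parameter family of partitions of `[0,2] × [0,1]`. -/
def Omega1 (θ : ℝ) : Set (ℝ × ℝ) :=
  if θ = π / 2 then Set.Icc (0 : ℝ) 1 ×ˢ Set.Icc (0 : ℝ) 1
  else if θ < arctan (1 / 2) then {p ∈ I2 | p.2 ≤ (1 - p.1) * tan θ + 1 / 2}
  else {p ∈ I2 | (p.1 - 1) * tan θ + p.2 ≤ 1 / 2}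

/-- The cell `Ω₂(θ)`: the closure of the complement of `Ω₁(θ)` in `[0,2] × [0,1]`. -/
def Omega2 (θ : ℝ) : Set (ℝ × ℝ) := closure (I2 \ Omega1 θ)

/-- The anchor point `a = ((m-2)/m, (m-1)/m, …, (m-1)/m)`. -/
def anchor (m d : ℕ) : Fin d → ℝ := fun j => if (j : ℕ) = 0 then ((m : ℝ) - 2) / m else ((m : ℝ) - 1) / m

/-- The two corner cells `a + (1/m)·(Ωᵢ(θ) × [0,1]^{d-2})`, `i = 1, 2`. -/
def cornerCell (m d : ℕ) (hd : 2 ≤ d) (θ : ℝ) (i : Fin 2) : Set (Fin d → ℝ) :=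
  (fun x : Fin d → ℝ => fun j => anchor m d j + x j / m) ''
    {x : Fin d → ℝ |
      (x ⟨0, by omega⟩, x ⟨1, by omega⟩) ∈ (if i = 0 then Omega1 θ else Omega2 θ) ∧
      ∀ j : Fin d, 2 ≤ (j : ℕ) → x j ∈ Set.Icc (0 : ℝ) 1}

/-- The axis-parallel grid cell of side `1/m` indexed by `k`. -/
def gridCell {d : ℕ} (m : ℕ) (k : Fin d → Fin m) : Set (Fin d → ℝ) :=
  Set.univ.pi fun j => Set.Ico ((k j : ℝ) / m) (((k j : ℝ) + 1) / m)

open scoped Classical in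
/-- The partition `Ω*∼(θ)` of `[0,1]^d`: all grid cells of side `1/m` except the two
top-corner ones, which are replaced by the two cells `a + (1/m)·(Ωᵢ(θ) × [0,1]^{d-2})`. -/
def OmegaStarSim (m d : ℕ) (hd : 2 ≤ d) (θ : ℝ) : (Fin d → Fin m) → Set (Fin d → ℝ) :=
  fun k =>
    if ∀ j : Fin d, (k j : ℕ) = (if (j : ℕ) = 0 then m - 2 else m - 1) then
      cornerCell m d hd θ 0
    else if ∀ j : Fin d, (k j : ℕ) = m - 1 then cornerCell m d hd θ 1
    else gridCell m k

end

noncomputable section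
/-- The area of the part of `[0, u) × [0, v)` lying beyond the line
`x + s * y = (1 + s) / 2` through the centre of the unit square. -/
def beyondArea (s u v : ℝ) : ℝ := ∫ y in (0 : ℝ)..v, max 0 (u - 1 / 2 - s / 2 + s * y)

lemma continuous_beyondArea (s : ℝ) : Continuous fun p : ℝ × ℝ => beyondArea s p.1 p.2 := by
  unfold beyondArea
  exact intervalIntegral.continuous_parametric_primitive_of_continuous
    (f := fun u y => max 0 (u - 1 / 2 - s / 2 + s * y)) (by fun_prop)

lemma integral_quintic (a b c₀ c₁ c₂ c₃ c₄ c₅ : ℝ) :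
    ∫ x in a..b, (c₀ + c₁ * x + c₂ * x ^ 2 + c₃ * x ^ 3 + c₄ * x ^ 4 + c₅ * x ^ 5) =
      (c₀ * b + c₁ * b ^ 2 / 2 + c₂ * b ^ 3 / 3 + c₃ * b ^ 4 / 4 + c₄ * b ^ 5 / 5
        + c₅ * b ^ 6 / 6) -
      (c₀ * a + c₁ * a ^ 2 / 2 + c₂ * a ^ 3 / 3 + c₃ * a ^ 4 / 4 + c₄ * a ^ 5 / 5
        + c₅ * a ^ 6 / 6) := by
  refine intervalIntegral.integral_eq_sub_of_hasDerivAt (f := fun x : ℝ =>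
    c₀ * x + c₁ * x ^ 2 / 2 + c₂ * x ^ 3 / 3 + c₃ * x ^ 4 / 4 + c₄ * x ^ 5 / 5
      + c₅ * x ^ 6 / 6) (fun x _ => ?_) (Continuous.intervalIntegrable (by fun_prop) _ _)
  have hpow (n : ℕ) (c : ℝ) := ((hasDerivAt_pow n x).const_mul c).div_const (n : ℝ)
  have h := (((((((hasDerivAt_id' x).const_mul c₀).fun_add (hpow 2 c₁)).fun_add (hpow 3 c₂)).fun_add
    (hpow 4 c₃)).fun_add (hpow 5 c₄)).fun_add (hpow 6 c₅))
  convert h using 1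
  norm_num
  ring

lemma beyondArea_eq_zero {s u v : ℝ} (hs : 0 ≤ s) (hv : 0 ≤ v)
    (h : u - 1 / 2 - s / 2 + s * v ≤ 0) : beyondArea s u v = 0 := by
  unfold beyondArea
  refine intervalIntegral.integral_zero_ae (.of_forall fun y hy => ?_)
  rw [uIoc_of_le hv] at hy
  have := mul_le_mul_of_nonneg_left hy.2 hs
  exact max_eq_left (by linarith)

lemma beyondArea_of_le {s u v : ℝ} (hs : 0 ≤ s) (hv : 0 ≤ v)
    (h : 0 ≤ u - 1 / 2 - s / 2) :
    beyondArea s u v = (u - 1 / 2 - s / 2) * v + s * v ^ 2 / 2 := by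
  have hcongr : beyondArea s u v = ∫ y in (0 : ℝ)..v, ((u - 1 / 2 - s / 2) + s * y + 0 * y ^ 2
      + 0 * y ^ 3 + 0 * y ^ 4 + 0 * y ^ 5) := by
    refine intervalIntegral.integral_congr fun y hy => ?_
    rw [uIcc_of_le hv] at hy
    have := mul_nonneg hs hy.1
    simp only [max_eq_right (by linarith : 0 ≤ u - 1 / 2 - s / 2 + s * y)]
    ring
  rw [hcongr, integral_quintic]
  ring

lemma beyondArea_of_crossing {s v w : ℝ} (hs : 0 ≤ s) (hw : 0 ≤ w) (hv : w ≤ v) :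
    beyondArea s (1 / 2 + s / 2 - s * w) v = s / 2 * (v - w) ^ 2 := by
  have hzero := beyondArea_eq_zero (u := 1 / 2 + s / 2 - s * w) hs hw (by linarith)
  have hint (a b : ℝ) : IntervalIntegrable
      (fun y => max 0 (1 / 2 + s / 2 - s * w - 1 / 2 - s / 2 + s * y)) volume a b :=
    Continuous.intervalIntegrable (by fun_prop) _ _
  unfold beyondArea at hzero ⊢
  rw [← intervalIntegral.integral_add_adjacent_intervals (hint 0 w) (hint w v), hzero, zero_add]
  have hcongr : ∫ y in w..v, max 0 (1 / 2 + s / 2 - s * w - 1 / 2 - s / 2 + s * y) =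
      ∫ y in w..v, (-(s * w) + s * y + 0 * y ^ 2 + 0 * y ^ 3 + 0 * y ^ 4 + 0 * y ^ 5) := by
    refine intervalIntegral.integral_congr fun y hy => ?_
    rw [uIcc_of_le hv] at hy
    have := mul_le_mul_of_nonneg_left hy.1 hs
    simp only [max_eq_right
      (by linarith : 0 ≤ 1 / 2 + s / 2 - s * w - 1 / 2 - s / 2 + s * y)]
    ring
  rw [hcongr, integral_quintic]
  ring

/-- The product of the areas of the two parts of `[0, u) × [0, v)`, integrated over `v`. -/
def sliceProduct (s u : ℝ) : ℝ :=
  ∫ v in (0 : ℝ)..1, beyondArea s u v * (u * v - beyondArea s u v)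

lemma continuous_sliceProduct (s : ℝ) : Continuous (sliceProduct s) := by
  unfold sliceProduct
  have := continuous_beyondArea s
  exact intervalIntegral.continuous_parametric_intervalIntegral_of_continuous'
    (f := fun u v => beyondArea s u v * (u * v - beyondArea s u v))
    (by simp only [Function.uncurry_def]; fun_prop) 0 1

lemma sliceProduct_eq_zero {s u : ℝ} (hs : 0 ≤ s) (hu : u ≤ 1 / 2 - s / 2) :
    sliceProduct s u = 0 := by
  refine intervalIntegral.integral_zero_ae (.of_forall fun v hv => ?_)
  rw [uIoc_of_le zero_le_one] at hv
  have := mul_le_mul_of_nonneg_left hv.2 hs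
  rw [beyondArea_eq_zero hs hv.1.le (by linarith), zero_mul]

lemma sliceProduct_of_le {s u : ℝ} (hs : 0 ≤ s) (hu : 1 / 2 + s / 2 ≤ u) :
    sliceProduct s u = (u - 1 / 2 - s / 2) * ((1 + s) / 6 - s / 8) + s / 16 + s ^ 2 / 80 := by
  have hcongr : sliceProduct s u = ∫ v in (0 : ℝ)..1, (0 + 0 * v
      + (u - 1 / 2 - s / 2) * (1 / 2 + s / 2) * v ^ 2
      + (s / 2 * (1 / 2 + s / 2) - (u - 1 / 2 - s / 2) * s / 2) * v ^ 3
      + -(s ^ 2 / 4) * v ^ 4 + 0 * v ^ 5) := by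
    refine intervalIntegral.integral_congr fun v hv => ?_
    rw [uIcc_of_le zero_le_one] at hv
    simp only [beyondArea_of_le hs hv.1 (by linarith : 0 ≤ u - 1 / 2 - s / 2)]
    ring
  rw [hcongr, integral_quintic]
  ring

lemma sliceProduct_of_crossing {s w : ℝ} (hs : 0 ≤ s) (hw : w ∈ Icc (0 : ℝ) 1) :
    sliceProduct s (1 / 2 + s / 2 - s * w) =
      s / 2 * ((1 / 2 + s / 2 - s * w) * ((1 - w) ^ 4 / 4 + w * (1 - w) ^ 3 / 3)
        - s / 10 * (1 - w) ^ 5) := by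
  set u := 1 / 2 + s / 2 - s * w with hu
  have hcont := continuous_beyondArea s
  have hint (a b : ℝ) : IntervalIntegrable
      (fun v => beyondArea s u v * (u * v - beyondArea s u v)) volume a b := by
    have : Continuous fun v => beyondArea s u v :=
      hcont.comp (by fun_prop : Continuous fun v => (u, v))
    exact Continuous.intervalIntegrable (by fun_prop) _ _
  have hzero : ∫ v in (0 : ℝ)..w, beyondArea s u v * (u * v - beyondArea s u v) = 0 := by
    refine intervalIntegral.integral_zero_ae (.of_forall fun v hv => ?_)
    rw [uIoc_of_le hw.1] at hv
    have := mul_le_mul_of_nonneg_left hv.2 hs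
    rw [beyondArea_eq_zero hs hv.1.le (by linarith), zero_mul]
  rw [sliceProduct, ← intervalIntegral.integral_add_adjacent_intervals (hint 0 w) (hint w 1), hzero,
    zero_add]
  have hcongr : ∫ v in w..1, beyondArea s u v * (u * v - beyondArea s u v) =
      ∫ v in w..1, (-(s ^ 2 / 4 * w ^ 4) + (s / 2 * u * w ^ 2 + s ^ 2 * w ^ 3) * v
        + (-(s * u * w) - 3 / 2 * s ^ 2 * w ^ 2) * v ^ 2
        + (s / 2 * u + s ^ 2 * w) * v ^ 3 + -(s ^ 2 / 4) * v ^ 4 + 0 * v ^ 5) := by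
    refine intervalIntegral.integral_congr fun v hv => ?_
    rw [uIcc_of_le hw.2] at hv
    simp only [hu, beyondArea_of_crossing hs hw.1 hv.1]
    ring
  rw [hcongr, integral_quintic]
  ring

lemma integral_sliceProduct {s : ℝ} (hs : s ∈ Icc (0 : ℝ) 1) :
    ∫ u in (0 : ℝ)..1, sliceProduct s u
      = 1 / 48 - s / 192 + s ^ 2 / 480 + s ^ 3 / 2880 := by
  have hint (a b : ℝ) := (continuous_sliceProduct s).intervalIntegrable (μ := volume) a b
  have hleft : ∫ u in (0 : ℝ)..(1 / 2 - s / 2), sliceProduct s u = 0 := by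
    refine intervalIntegral.integral_zero_ae (.of_forall fun u hu => ?_)
    rw [uIoc_of_le (by linarith [hs.2])] at hu
    exact sliceProduct_eq_zero hs.1 hu.2
  have hright : ∫ u in (1 / 2 + s / 2)..1, sliceProduct s u =
      (1 - s) ^ 2 / 8 * (1 / 6 + s / 24) + (1 - s) / 2 * (s / 16 + s ^ 2 / 80) := by
    have hcongr : ∫ u in (1 / 2 + s / 2)..1, sliceProduct s u = ∫ u in (1 / 2 + s / 2)..1,
        ((-1 / 2 - s / 2) * ((1 + s) / 6 - s / 8) + s / 16 + s ^ 2 / 80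
          + ((1 + s) / 6 - s / 8) * u + 0 * u ^ 2 + 0 * u ^ 3 + 0 * u ^ 4 + 0 * u ^ 5) := by
      refine intervalIntegral.integral_congr fun u hu => ?_
      rw [uIcc_of_le (by linarith [hs.2])] at hu
      simp only [sliceProduct_of_le hs.1 hu.1]
      ring
    rw [hcongr, integral_quintic]
    ring
  have hmid : ∫ u in (1 / 2 - s / 2)..(1 / 2 + s / 2), sliceProduct s u
      = s ^ 2 / 60 + s ^ 3 / 720 := by
    have hsub := intervalIntegral.smul_integral_comp_sub_mul (a := 0) (b := 1)
      (sliceProduct s) s (1 / 2 + s / 2)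
    rw [show 1 / 2 + s / 2 - s * 1 = 1 / 2 - s / 2 by ring,
      show 1 / 2 + s / 2 - s * 0 = 1 / 2 + s / 2 by ring] at hsub
    rw [← hsub]
    have hcongr : ∫ w in (0 : ℝ)..1, sliceProduct s (1 / 2 + s / 2 - s * w) =
        ∫ w in (0 : ℝ)..1, (s / 16 + s ^ 2 / 80 + (-(s / 6) - s ^ 2 / 24) * w
          + (s / 8 - s ^ 2 / 24) * w ^ 2 + s ^ 2 / 4 * w ^ 3
          + (-(s / 48) - 13 / 48 * s ^ 2) * w ^ 4 + 11 / 120 * s ^ 2 * w ^ 5) := by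
      refine intervalIntegral.integral_congr fun w hw => ?_
      rw [uIcc_of_le zero_le_one] at hw
      simp only [sliceProduct_of_crossing hs.1 hw]
      ring
    rw [hcongr, integral_quintic]
    simp only [smul_eq_mul]
    ring
  rw [← intervalIntegral.integral_add_adjacent_intervals (hint 0 (1 / 2 - s / 2)) (hint _ 1),
    ← intervalIntegral.integral_add_adjacent_intervals (hint (1 / 2 - s / 2) (1 / 2 + s / 2))
      (hint _ 1), hleft, hmid, hright]
  ring

lemma integral_sliceProduct_le {s : ℝ} (hs : s ∈ Icc (0 : ℝ) 1) :
    ∫ u in (0 : ℝ)..1, sliceProduct s u ≤ ∫ u in (0 : ℝ)..1, sliceProduct 0 u := by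
  rw [integral_sliceProduct hs, integral_sliceProduct (by simp)]
  obtain ⟨h0, h1⟩ := hs
  nlinarith [mul_nonneg h0 (sub_nonneg.2 h1), mul_nonneg (mul_nonneg h0 h0) (sub_nonneg.2 h1)]

lemma Omega1_pi_div_two : Omega1 (π / 2) = {p ∈ I2 | p.1 - (1 + 0 - 2 * 0 * p.2) ≤ 0} := by
  rw [Omega1, if_pos rfl]
  ext p
  simp only [I2, mem_prod, mem_Icc, mem_ofPred_eq]
  constructor
  · rintro ⟨⟨_, _⟩, _, _⟩
    refine ⟨⟨⟨?_, ?_⟩, ?_, ?_⟩, ?_⟩ <;> linarith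
  · rintro ⟨⟨⟨_, _⟩, _, _⟩, _⟩
    refine ⟨⟨?_, ?_⟩, ?_, ?_⟩ <;> linarith

lemma Omega1_eq_or (θ : ℝ) (hθ : θ ∈ Icc 0 (π / 2)) : ∃ s ∈ Icc (0 : ℝ) 1,
    Omega1 θ = {p ∈ I2 | p.1 - (1 + s - 2 * s * p.2) ≤ 0} ∨
      Omega1 θ = {p ∈ I2 | p.2 - (1 / 2 + s / 2 - s / 2 * p.1) ≤ 0} := by
  by_cases htop : θ = π / 2
  · exact ⟨0, by simp, .inl (htop ▸ Omega1_pi_div_two)⟩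
  have hlt : θ < π / 2 := lt_of_le_of_ne hθ.2 htop
  have hhalf_mem : arctan (1 / 2) ∈ Ioo (-(π / 2)) (π / 2) := arctan_mem_Ioo _
  have hθ_mem : θ ∈ Ioo (-(π / 2)) (π / 2) := ⟨by linarith [hθ.1, pi_pos], hlt⟩
  by_cases hsmall : θ < arctan (1 / 2)
  · have htan : tan θ < 1 / 2 := by
      simpa only [tan_arctan] using strictMonoOn_tan hθ_mem hhalf_mem hsmall
    have htan0 : 0 ≤ tan θ := tan_nonneg_of_nonneg_of_le_pi_div_two hθ.1 hθ.2
    refine ⟨2 * tan θ, ⟨by linarith, by linarith⟩, .inr ?_⟩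
    rw [Omega1, if_neg htop, if_pos hsmall]
    ext p
    simp only [mem_ofPred_eq]
    refine and_congr_right fun _ => ?_
    constructor <;> intro h <;> linarith
  · have htan : 1 / 2 ≤ tan θ := by
      simpa only [tan_arctan] using
        strictMonoOn_tan.monotoneOn hhalf_mem hθ_mem (not_lt.1 hsmall)
    have hpos : 0 < tan θ := by linarith
    refine ⟨(2 * tan θ)⁻¹, ⟨by positivity, inv_le_one_of_one_le₀ (by linarith)⟩, .inl ?_⟩
    rw [Omega1, if_neg htop, if_neg hsmall]
    ext p
    simp only [mem_ofPred_eq]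
    refine and_congr_right fun _ => ?_
    have hfactor : p.1 - (1 + (2 * tan θ)⁻¹ - 2 * (2 * tan θ)⁻¹ * p.2)
        = (tan θ)⁻¹ * ((p.1 - 1) * tan θ + p.2 - 1 / 2) := by
      field_simp
      ring
    rw [hfactor, ← sub_nonpos]
    exact ⟨fun h => mul_nonpos_of_nonneg_of_nonpos (inv_pos.2 hpos).le h, fun h =>
      not_lt.1 fun h' => absurd (mul_pos (inv_pos.2 hpos) h') (not_lt.2 h)⟩

lemma isClosed_I2 : IsClosed I2 := isClosed_Icc.prod isClosed_Icc

lemma volume_I2 : volume I2 = 2 := by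
  rw [I2, Measure.volume_eq_prod, Measure.prod_prod]
  simp

/-- The graph of a continuous function over the second coordinate is a null set. -/
lemma volume_graph_snd (f : ℝ → ℝ) (hf : Continuous f) :
    volume {p : ℝ × ℝ | p.1 - f p.2 = 0} = 0 := by
  have hmeas : MeasurableSet {p : ℝ × ℝ | p.1 - f p.2 = 0} :=
    (isClosed_eq (by fun_prop) continuous_const).measurableSet
  rw [Measure.volume_eq_prod, Measure.prod_apply_symm hmeas]
  refine (lintegral_congr fun y => ?_).trans lintegral_zero
  refine measure_mono_null (t := {f y}) (fun x hx => ?_) (by simp)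
  exact sub_eq_zero.1 hx

lemma volume_graph_fst (f : ℝ → ℝ) (hf : Continuous f) :
    volume {p : ℝ × ℝ | p.2 - f p.1 = 0} = 0 := by
  have hmeas : MeasurableSet {p : ℝ × ℝ | p.1 - f p.2 = 0} :=
    (isClosed_eq (by fun_prop) continuous_const).measurableSet
  have h := (Measure.measurePreserving_swap (μ := (volume : Measure ℝ))
    (ν := (volume : Measure ℝ))).measure_preimage hmeas.nullMeasurableSet
  exact h.trans (volume_graph_snd f hf)

lemma closure_diff_ae_eq {l : ℝ × ℝ → ℝ} (hl : Continuous l) (hnull : volume {p | l p = 0} = 0) :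
    closure (I2 \ {p ∈ I2 | l p ≤ 0}) =ᵐ[volume] (I2 \ {p ∈ I2 | l p ≤ 0} : Set (ℝ × ℝ)) := by
  have hclosed : IsClosed (I2 ∩ {p | 0 ≤ l p}) :=
    isClosed_I2.inter (isClosed_le continuous_const hl)
  have hsub : closure (I2 \ {p ∈ I2 | l p ≤ 0}) ⊆ I2 ∩ {p | 0 ≤ l p} := by
    refine closure_minimal (fun p hp => ⟨hp.1, ?_⟩) hclosed
    by_contra h
    exact hp.2 ⟨hp.1, (not_le.1 h).le⟩
  refine (Filter.EventuallyLE.antisymm subset_closure.eventuallyLE ?_).symm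
  refine ae_le_set.2 (measure_mono_null (fun p hp => ?_) hnull)
  obtain ⟨hI, hle⟩ := hsub hp.1
  refine le_antisymm ?_ hle
  by_contra h
  exact hp.2 ⟨hI, fun h' => h h'.2⟩

lemma Omega2_ae_eq {θ : ℝ} (hθ : θ ∈ Icc 0 (π / 2)) :
    Omega2 θ =ᵐ[volume] (I2 \ Omega1 θ : Set (ℝ × ℝ)) := by
  obtain ⟨s, -, h | h⟩ := Omega1_eq_or θ hθ
  · rw [Omega2, h]
    exact closure_diff_ae_eq (by fun_prop)
      (volume_graph_snd (fun y => 1 + s - 2 * s * y) (by fun_prop))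
  · rw [Omega2, h]
    exact closure_diff_ae_eq (by fun_prop)
      (volume_graph_fst (fun x => 1 / 2 + s / 2 - s / 2 * x) (by fun_prop))

lemma isClosed_Omega1 {θ : ℝ} (hθ : θ ∈ Icc 0 (π / 2)) : IsClosed (Omega1 θ) := by
  have hclosed {l : ℝ × ℝ → ℝ} (hl : Continuous l) : IsClosed {p ∈ I2 | l p ≤ 0} :=
    isClosed_I2.inter (isClosed_le hl continuous_const)
  obtain ⟨s, -, h | h⟩ := Omega1_eq_or θ hθ <;> rw [h] <;> exact hclosed (by fun_prop)

lemma Omega1_subset_I2 {θ : ℝ} (hθ : θ ∈ Icc 0 (π / 2)) : Omega1 θ ⊆ I2 := by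
  obtain ⟨s, -, h | h⟩ := Omega1_eq_or θ hθ <;> rw [h] <;> exact fun p hp => hp.1

/-- The two cells of the partition of `[0,2] × [0,1]`, indexed by `Fin 2`. -/
def planeCell (θ : ℝ) (i : Fin 2) : Set (ℝ × ℝ) := if i = 0 then Omega1 θ else Omega2 θ

lemma planeCell_subset_I2 {θ : ℝ} (hθ : θ ∈ Icc 0 (π / 2)) (i : Fin 2) : planeCell θ i ⊆ I2 := by
  unfold planeCell
  split_ifs
  · exact Omega1_subset_I2 hθ
  · exact closure_minimal sdiff_subset isClosed_I2

lemma measurableSet_planeCell {θ : ℝ} (hθ : θ ∈ Icc 0 (π / 2)) (i : Fin 2) :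
    MeasurableSet (planeCell θ i) := by
  unfold planeCell
  split_ifs
  · exact (isClosed_Omega1 hθ).measurableSet
  · exact isClosed_closure.measurableSet

/-- The open lower-left quadrant with corner `w`. -/
def quadrant (w : ℝ × ℝ) : Set (ℝ × ℝ) := Iio w.1 ×ˢ Iio w.2

/-- The area of the part of a plane cell below and to the left of `w`. -/
def cellArea (θ : ℝ) (i : Fin 2) (w : ℝ × ℝ) : ℝ := volume.real (planeCell θ i ∩ quadrant w)

lemma cellArea_add {θ : ℝ} (hθ : θ ∈ Icc 0 (π / 2)) (w : ℝ × ℝ) :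
    cellArea θ 0 w + cellArea θ 1 w = volume.real (I2 ∩ quadrant w) := by
  have h2 : cellArea θ 1 w = volume.real ((I2 \ Omega1 θ) ∩ quadrant w) := by
    refine measureReal_congr ?_
    exact (Omega2_ae_eq hθ).inter (ae_eq_refl _)
  rw [h2, cellArea, planeCell, if_pos rfl]
  have hfin : volume (I2 ∩ quadrant w) ≠ ⊤ :=
    measure_ne_top_of_subset inter_subset_left (by simp [volume_I2])
  rw [← measureReal_inter_add_sdiff (s := I2 ∩ quadrant w) (isClosed_Omega1 hθ).measurableSet hfin]
  congr 2
  · ext p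
    have := @Omega1_subset_I2 θ hθ p
    simp only [mem_inter_iff]
    tauto
  · ext p
    simp only [mem_inter_iff, mem_sdiff]
    tauto

lemma cellArea_eq_zero {θ : ℝ} (hθ : θ ∈ Icc 0 (π / 2)) (i : Fin 2) {x y : ℝ}
    (hw : x ≤ 0 ∨ y ≤ 0) : cellArea θ i (x, y) = 0 := by
  have hempty : planeCell θ i ∩ quadrant (x, y) = ∅ := by
    refine eq_empty_of_forall_notMem fun p hp => ?_
    have hI := planeCell_subset_I2 hθ i hp.1
    have h1 : p.1 < x := hp.2.1
    have h2 : p.2 < y := hp.2.2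
    have h3 : 0 ≤ p.1 := hI.1.1
    have h4 : 0 ≤ p.2 := hI.2.1
    rcases hw with h | h <;> linarith
  rw [cellArea, hempty, measureReal_empty]

lemma cellArea_nonneg (θ : ℝ) (i : Fin 2) (w : ℝ × ℝ) : 0 ≤ cellArea θ i w := measureReal_nonneg

lemma cellArea_le {θ : ℝ} (hθ : θ ∈ Icc 0 (π / 2)) (i : Fin 2) (w : ℝ × ℝ) :
    cellArea θ i w ≤ 2 := by
  have h := measureReal_mono (μ := volume)
    (inter_subset_left.trans (planeCell_subset_I2 hθ i) : planeCell θ i ∩ quadrant w ⊆ I2)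
    (by simp [volume_I2])
  refine h.trans ?_
  rw [Measure.real, volume_I2]
  simp

lemma measurable_cellArea {θ : ℝ} (hθ : θ ∈ Icc 0 (π / 2)) (i : Fin 2) :
    Measurable (cellArea θ i) := by
  have hset : MeasurableSet {q : (ℝ × ℝ) × (ℝ × ℝ) |
      q.2 ∈ planeCell θ i ∧ q.2.1 < q.1.1 ∧ q.2.2 < q.1.2} :=
    (measurable_snd (measurableSet_planeCell hθ i)).inter
      ((measurableSet_lt (f := fun q : (ℝ × ℝ) × (ℝ × ℝ) => q.2.1) (g := fun q => q.1.1)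
        (by fun_prop) (by fun_prop)).inter
        (measurableSet_lt (f := fun q : (ℝ × ℝ) × (ℝ × ℝ) => q.2.2) (g := fun q => q.1.2)
          (by fun_prop) (by fun_prop)))
  exact (measurable_measure_prodMk_left (ν := (volume : Measure (ℝ × ℝ))) hset).ennreal_toReal

lemma volume_real_I2_inter_quadrant {u v : ℝ} (hu : u ∈ Icc (0 : ℝ) 1) (hv : v ∈ Icc (0 : ℝ) 1) :
    volume.real (I2 ∩ quadrant (2 * u, v)) = 2 * u * v := by
  have hset : I2 ∩ quadrant (2 * u, v) = Ico 0 (2 * u) ×ˢ Ico 0 v := by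
    ext p
    simp only [I2, quadrant, mem_inter_iff, mem_prod, mem_Icc, mem_Iio, mem_Ico]
    constructor
    · rintro ⟨⟨⟨_, _⟩, _, _⟩, _, _⟩
      exact ⟨⟨‹_›, ‹_›⟩, ‹_›, ‹_›⟩
    · rintro ⟨⟨_, _⟩, _, _⟩
      refine ⟨⟨⟨‹_›, ?_⟩, ‹_›, ?_⟩, ‹_›, ‹_›⟩ <;> linarith [hu.2, hv.2]
  rw [hset, Measure.volume_eq_prod, measureReal_prod_prod,
    Real.volume_real_Ico_of_le (by linarith [hu.1]), Real.volume_real_Ico_of_le hv.1]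
  ring

/-- The area between a graph over `[0, b)` and the horizontal line at height `a`. -/
lemma volume_real_above_graph {f : ℝ → ℝ} (hf : Continuous f) (a : ℝ) {b : ℝ} (hb : 0 ≤ b) :
    volume.real {p : ℝ × ℝ | p.1 ∈ Ico 0 b ∧ f p.1 < p.2 ∧ p.2 < a} =
      ∫ x in (0 : ℝ)..b, max 0 (a - f x) := by
  have hset : {p : ℝ × ℝ | p.1 ∈ Ico 0 b ∧ f p.1 < p.2 ∧ p.2 < a} =
      regionBetween f (fun x => max (f x) a) (Ico 0 b) := by
    ext p
    simp only [regionBetween, mem_ofPred_eq, mem_Ioo, lt_max_iff]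
    refine and_congr_right fun _ => and_congr_right fun h => ?_
    constructor
    · exact .inr
    · rintro (h' | h')
      · exact absurd h (not_lt.2 h'.le)
      · exact h'
  have hint (g : ℝ → ℝ) (hg : Continuous g) : IntegrableOn g (Ico 0 b) :=
    hg.integrableOn_Icc.mono_set Ico_subset_Icc_self
  rw [Measure.real, hset, Measure.volume_eq_prod, volume_regionBetween_eq_integral (hint _ hf)
    (hint _ (hf.max continuous_const)) measurableSet_Ico fun x _ => le_max_left _ _,
    ENNReal.toReal_ofReal (integral_nonneg fun x => by simp), intervalIntegral.integral_of_le hb,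
    integral_Ico_eq_integral_Ioo, integral_Ioc_eq_integral_Ioo]
  refine integral_congr_ae (.of_forall fun x => ?_)
  simp only [Pi.sub_apply, ← max_sub_sub_right, sub_self]

lemma volume_real_right_of_graph {f : ℝ → ℝ} (hf : Continuous f) (a : ℝ) {b : ℝ} (hb : 0 ≤ b) :
    volume.real {p : ℝ × ℝ | p.2 ∈ Ico 0 b ∧ f p.2 < p.1 ∧ p.1 < a} =
      ∫ x in (0 : ℝ)..b, max 0 (a - f x) := by
  have hmeas : MeasurableSet {p : ℝ × ℝ | p.1 ∈ Ico 0 b ∧ f p.1 < p.2 ∧ p.2 < a} :=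
    (measurable_fst measurableSet_Ico).inter
      ((measurableSet_lt (hf.measurable.comp measurable_fst) measurable_snd).inter
        (measurableSet_lt measurable_snd measurable_const))
  have h := (Measure.measurePreserving_swap (μ := (volume : Measure ℝ))
    (ν := (volume : Measure ℝ))).measure_preimage hmeas.nullMeasurableSet
  rw [← volume_real_above_graph hf a hb]
  exact congrArg ENNReal.toReal h

lemma cellArea_one_of_steep {θ s u v : ℝ} (hθ : θ ∈ Icc 0 (π / 2)) (hs : s ∈ Icc (0 : ℝ) 1)
    (h : Omega1 θ = {p ∈ I2 | p.1 - (1 + s - 2 * s * p.2) ≤ 0})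
    (hu : u ∈ Icc (0 : ℝ) 1) (hv : v ∈ Icc (0 : ℝ) 1) :
    cellArea θ 1 (2 * u, v) = 2 * beyondArea s u v := by
  have hcongr : cellArea θ 1 (2 * u, v) =
      volume.real ((I2 \ Omega1 θ) ∩ quadrant (2 * u, v)) :=
    measureReal_congr ((Omega2_ae_eq hθ).inter (ae_eq_refl _))
  have hset : (I2 \ Omega1 θ) ∩ quadrant (2 * u, v) =
      {p : ℝ × ℝ | p.2 ∈ Ico 0 v ∧ 1 + s - 2 * s * p.2 < p.1 ∧ p.1 < 2 * u} := by
    rw [h]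
    ext p
    simp only [I2, quadrant, mem_inter_iff, mem_sdiff, mem_prod, mem_Icc, mem_Iio, mem_Ico,
      mem_ofPred_eq, not_and, not_le]
    constructor
    · rintro ⟨⟨hI, hp⟩, h1, h2⟩
      exact ⟨⟨hI.2.1, h2⟩, by linarith [hp hI], h1⟩
    · rintro ⟨⟨h0, h2⟩, hp, h1⟩
      have h3 := mul_le_mul_of_nonneg_left (h2.le.trans hv.2) hs.1
      refine ⟨⟨⟨⟨?_, ?_⟩, h0, ?_⟩, fun _ => ?_⟩, h1, h2⟩ <;> linarith [hs.1, hs.2, hu.2, hv.2]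
  rw [hcongr, hset, volume_real_right_of_graph (f := fun y => 1 + s - 2 * s * y)
    (by fun_prop) _ hv.1, beyondArea, ← intervalIntegral.integral_const_mul]
  congr 1
  ext y
  rw [mul_max_of_nonneg _ _ zero_le_two]
  congr 1 <;> ring

lemma cellArea_one_of_flat {θ s u v : ℝ} (hθ : θ ∈ Icc 0 (π / 2)) (hs : s ∈ Icc (0 : ℝ) 1)
    (h : Omega1 θ = {p ∈ I2 | p.2 - (1 / 2 + s / 2 - s / 2 * p.1) ≤ 0})
    (hu : u ∈ Icc (0 : ℝ) 1) (hv : v ∈ Icc (0 : ℝ) 1) :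
    cellArea θ 1 (2 * u, v) = 2 * beyondArea s v u := by
  have hcongr : cellArea θ 1 (2 * u, v) =
      volume.real ((I2 \ Omega1 θ) ∩ quadrant (2 * u, v)) :=
    measureReal_congr ((Omega2_ae_eq hθ).inter (ae_eq_refl _))
  have hset : (I2 \ Omega1 θ) ∩ quadrant (2 * u, v) =
      {p : ℝ × ℝ | p.1 ∈ Ico 0 (2 * u) ∧ 1 / 2 + s / 2 - s / 2 * p.1 < p.2 ∧ p.2 < v} := by
    rw [h]
    ext p
    simp only [I2, quadrant, mem_inter_iff, mem_sdiff, mem_prod, mem_Icc, mem_Iio, mem_Ico,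
      mem_ofPred_eq, not_and, not_le]
    constructor
    · rintro ⟨⟨hI, hp⟩, h1, h2⟩
      exact ⟨⟨hI.1.1, h1⟩, by linarith [hp hI], h2⟩
    · rintro ⟨⟨h0, h1⟩, hp, h2⟩
      have h3 := mul_le_mul_of_nonneg_left (h1.le.trans (by linarith [hu.2] : 2 * u ≤ 2)) hs.1
      refine ⟨⟨⟨⟨h0, ?_⟩, ?_, ?_⟩, fun _ => ?_⟩, h1, h2⟩ <;> linarith [hs.1, hs.2, hu.2, hv.2]
  have hscale := intervalIntegral.mul_integral_comp_mul_left (a := 0) (b := u)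
    (f := fun x => max 0 (v - (1 / 2 + s / 2 - s / 2 * x))) (c := 2)
  rw [mul_zero] at hscale
  rw [hcongr, hset, volume_real_above_graph (f := fun x => 1 / 2 + s / 2 - s / 2 * x)
    (by fun_prop) _ (by linarith [hu.1]), ← hscale, beyondArea]
  congr 2
  ext y
  congr 1
  ring

lemma volume_real_planeCell {θ : ℝ} (hθ : θ ∈ Icc 0 (π / 2)) (i : Fin 2) :
    volume.real (planeCell θ i) = 1 := by
  have hI : (I2 : Set (ℝ × ℝ)) =ᵐ[volume] (I2 ∩ quadrant (2 * 1, 1) : Set (ℝ × ℝ)) := by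
    refine (Filter.EventuallyLE.antisymm inter_subset_left.eventuallyLE ?_).symm
    refine ae_le_set.2 (measure_mono_null (t := ({2} ×ˢ univ) ∪ (univ ×ˢ {1})) (fun p hp => ?_) ?_)
    · by_contra hmem
      simp only [mem_union, mem_prod, mem_singleton_iff, mem_univ, and_true, true_and,
        not_or] at hmem
      refine hp.2 ⟨hp.1, ?_, ?_⟩
      · rw [mul_one]
        exact lt_of_le_of_ne hp.1.1.2 hmem.1
      · exact lt_of_le_of_ne hp.1.2.2 hmem.2
    · rw [measure_union_null_iff, Measure.volume_eq_prod, Measure.prod_prod, Measure.prod_prod]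
      simp
  have hcell (j : Fin 2) : volume.real (planeCell θ j) = cellArea θ j (2 * 1, 1) := by
    refine measureReal_congr ?_
    have h := (ae_eq_refl (planeCell θ j)).inter hI
    rwa [inter_eq_left.2 (planeCell_subset_I2 hθ j), ← inter_assoc,
      inter_eq_left.2 (planeCell_subset_I2 hθ j)] at h
  have h1 : cellArea θ 1 (2 * 1, 1) = 1 := by
    obtain ⟨s, hs, h | h⟩ := Omega1_eq_or θ hθ
    · rw [cellArea_one_of_steep hθ hs h (by simp) (by simp),
        beyondArea_of_le hs.1 zero_le_one (by linarith [hs.2])]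
      ring
    · rw [cellArea_one_of_flat hθ hs h (by simp) (by simp),
        beyondArea_of_le hs.1 zero_le_one (by linarith [hs.2])]
      ring
  have hsum := cellArea_add hθ (2 * 1, 1)
  rw [volume_real_I2_inter_quadrant (by simp) (by simp)] at hsum
  rw [hcell]
  fin_cases i
  · change cellArea θ 0 (2 * 1, 1) = 1
    linarith
  · exact h1

lemma setIntegral_comp_mul_sub_of_eq_zero {h : ℝ → ℝ} (h0 : ∀ x ≤ 0, h x = 0) {m k : ℝ}
    (hk : 0 < k) (hkm : k ≤ m) :
    ∫ x in Icc (0 : ℝ) 1, h (m * x - (m - k)) = k / m * ∫ u in (0 : ℝ)..1, h (k * u) := by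
  have hm : 0 < m := hk.trans_le hkm
  rw [integral_Icc_eq_integral_Ioc, ← intervalIntegral.integral_of_le zero_le_one,
    intervalIntegral.integral_comp_mul_sub h hm.ne', mul_zero, mul_one, zero_sub, sub_sub_cancel,
    intervalIntegral.integral_comp_mul_left h hk.ne', mul_zero, mul_one,
    intervalIntegral.integral_of_le (by linarith), intervalIntegral.integral_of_le hk.le,
    setIntegral_eq_of_subset_of_forall_sdiff_eq_zero measurableSet_Ioc
      (Ioc_subset_Ioc_left (by linarith : -(m - k) ≤ 0))]
  · simp only [smul_eq_mul]
    field_simp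
  · rintro x ⟨hx, hx'⟩
    refine h0 x (not_lt.1 fun hpos => hx' ⟨hpos, hx.2⟩)

/-- The corner coordinates `m * (z - a)` of a point of the unit square. -/
def cornerCoord (m : ℝ) (z : ℝ × ℝ) : ℝ × ℝ := (m * z.1 - (m - 2), m * z.2 - (m - 1))

lemma integrableOn_cellArea_mul {θ : ℝ} (hθ : θ ∈ Icc 0 (π / 2)) (m : ℝ) :
    IntegrableOn (fun z => cellArea θ 0 (cornerCoord m z) * cellArea θ 1 (cornerCoord m z))
      (Icc (0 : ℝ) 1 ×ˢ Icc (0 : ℝ) 1) := by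
  have hcoord : Measurable (cornerCoord m) := by
    unfold cornerCoord
    fun_prop
  have hfin : volume (Icc (0 : ℝ) 1 ×ˢ Icc (0 : ℝ) 1) ≠ ⊤ :=
    (isCompact_Icc.prod isCompact_Icc).measure_lt_top.ne
  refine Measure.integrableOn_of_bounded (M := 2 * 2) hfin
    (((measurable_cellArea hθ 0).comp hcoord).mul
      ((measurable_cellArea hθ 1).comp hcoord)).aestronglyMeasurable (.of_forall fun z => ?_)
  rw [Real.norm_of_nonneg (mul_nonneg (cellArea_nonneg _ _ _) (cellArea_nonneg _ _ _))]
  exact mul_le_mul (cellArea_le hθ _ _) (cellArea_le hθ _ _) (cellArea_nonneg _ _ _) zero_le_two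

lemma cellArea_zero_eq {θ u v : ℝ} (hθ : θ ∈ Icc 0 (π / 2))
    (hu : u ∈ Icc (0 : ℝ) 1) (hv : v ∈ Icc (0 : ℝ) 1) :
    cellArea θ 0 (2 * u, v) = 2 * u * v - cellArea θ 1 (2 * u, v) := by
  rw [← volume_real_I2_inter_quadrant hu hv, ← cellArea_add hθ, add_sub_cancel_right]

lemma integral_cellArea_mul_of_steep {θ s m : ℝ} (hθ : θ ∈ Icc 0 (π / 2)) (hs : s ∈ Icc (0 : ℝ) 1)
    (h : Omega1 θ = {p ∈ I2 | p.1 - (1 + s - 2 * s * p.2) ≤ 0}) (hm : 2 ≤ m) :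
    ∫ z in Icc (0 : ℝ) 1 ×ˢ Icc (0 : ℝ) 1,
      cellArea θ 0 (cornerCoord m z) * cellArea θ 1 (cornerCoord m z) =
        8 / m ^ 2 * ∫ u in (0 : ℝ)..1, sliceProduct s u := by
  have hfubini := setIntegral_prod _ (integrableOn_cellArea_mul hθ m)
  rw [Measure.volume_eq_prod, hfubini]
  have hinner (x : ℝ) := setIntegral_comp_mul_sub_of_eq_zero (m := m)
    (h := fun v => cellArea θ 0 (m * x - (m - 2), v) * cellArea θ 1 (m * x - (m - 2), v))
    (fun v hv => by simp only [cellArea_eq_zero hθ 0 (.inr hv), zero_mul]) one_pos (by linarith)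
  have houter := setIntegral_comp_mul_sub_of_eq_zero (m := m)
    (h := fun x => 1 / m * ∫ v in (0 : ℝ)..1, cellArea θ 0 (x, 1 * v) * cellArea θ 1 (x, 1 * v))
    (fun x hx => by simp only [cellArea_eq_zero hθ 0 (.inl hx), zero_mul,
      intervalIntegral.integral_zero, mul_zero]) two_pos hm
  simp only [cornerCoord, hinner]
  rw [houter, intervalIntegral.integral_const_mul]
  have hslice : ∫ u in (0 : ℝ)..1, ∫ v in (0 : ℝ)..1,
      cellArea θ 0 (2 * u, 1 * v) * cellArea θ 1 (2 * u, 1 * v) =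
        ∫ u in (0 : ℝ)..1, 4 * sliceProduct s u := by
    refine intervalIntegral.integral_congr fun u hu => ?_
    rw [uIcc_of_le zero_le_one] at hu
    simp only [sliceProduct, ← intervalIntegral.integral_const_mul]
    refine intervalIntegral.integral_congr fun v hv => ?_
    rw [uIcc_of_le zero_le_one] at hv
    simp only [one_mul, cellArea_zero_eq hθ hu hv, cellArea_one_of_steep hθ hs h hu hv]
    ring
  rw [hslice, intervalIntegral.integral_const_mul]
  ring

lemma integral_cellArea_mul_of_flat {θ s m : ℝ} (hθ : θ ∈ Icc 0 (π / 2)) (hs : s ∈ Icc (0 : ℝ) 1)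
    (h : Omega1 θ = {p ∈ I2 | p.2 - (1 / 2 + s / 2 - s / 2 * p.1) ≤ 0}) (hm : 2 ≤ m) :
    ∫ z in Icc (0 : ℝ) 1 ×ˢ Icc (0 : ℝ) 1,
      cellArea θ 0 (cornerCoord m z) * cellArea θ 1 (cornerCoord m z) =
        8 / m ^ 2 * ∫ u in (0 : ℝ)..1, sliceProduct s u := by
  have hint : IntegrableOn (fun z : ℝ × ℝ => cellArea θ 0 (cornerCoord m z.swap) *
      cellArea θ 1 (cornerCoord m z.swap)) (Icc (0 : ℝ) 1 ×ˢ Icc (0 : ℝ) 1)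
      (volume.prod volume) :=
    (integrableOn_cellArea_mul hθ m).swap
  rw [Measure.volume_eq_prod, ← setIntegral_prod_swap, setIntegral_prod _ hint]
  have hinner (y : ℝ) := setIntegral_comp_mul_sub_of_eq_zero (m := m)
    (h := fun u => cellArea θ 0 (u, m * y - (m - 1)) * cellArea θ 1 (u, m * y - (m - 1)))
    (fun u hu => by simp only [cellArea_eq_zero hθ 0 (.inl hu), zero_mul]) two_pos hm
  have houter := setIntegral_comp_mul_sub_of_eq_zero (m := m)
    (h := fun y => 2 / m * ∫ u in (0 : ℝ)..1, cellArea θ 0 (2 * u, y) * cellArea θ 1 (2 * u, y))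
    (fun y hy => by simp only [cellArea_eq_zero hθ 0 (.inr hy), zero_mul,
      intervalIntegral.integral_zero, mul_zero]) one_pos (by linarith)
  simp only [cornerCoord, Prod.swap_prod_mk, hinner]
  rw [houter, intervalIntegral.integral_const_mul]
  have hslice : ∫ v in (0 : ℝ)..1, ∫ u in (0 : ℝ)..1,
      cellArea θ 0 (2 * u, 1 * v) * cellArea θ 1 (2 * u, 1 * v) =
        ∫ v in (0 : ℝ)..1, 4 * sliceProduct s v := by
    refine intervalIntegral.integral_congr fun v hv => ?_
    rw [uIcc_of_le zero_le_one] at hv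
    simp only [sliceProduct, ← intervalIntegral.integral_const_mul]
    refine intervalIntegral.integral_congr fun u hu => ?_
    rw [uIcc_of_le zero_le_one] at hu
    simp only [one_mul, cellArea_zero_eq hθ hu hv, cellArea_one_of_flat hθ hs h hu hv]
    ring
  rw [hslice, intervalIntegral.integral_const_mul]
  ring

lemma integral_cellArea_mul_le {θ m : ℝ} (hθ : θ ∈ Icc 0 (π / 2)) (hm : 2 ≤ m) :
    ∫ z in Icc (0 : ℝ) 1 ×ˢ Icc (0 : ℝ) 1,
      cellArea θ 0 (cornerCoord m z) * cellArea θ 1 (cornerCoord m z) ≤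
    ∫ z in Icc (0 : ℝ) 1 ×ˢ Icc (0 : ℝ) 1,
      cellArea (π / 2) 0 (cornerCoord m z) * cellArea (π / 2) 1 (cornerCoord m z) := by
  rw [integral_cellArea_mul_of_steep ⟨by positivity, le_rfl⟩ (by simp) Omega1_pi_div_two hm]
  obtain ⟨s, hs, h | h⟩ := Omega1_eq_or θ hθ
  · rw [integral_cellArea_mul_of_steep hθ hs h hm]
    exact mul_le_mul_of_nonneg_left (integral_sliceProduct_le hs) (by positivity)
  · rw [integral_cellArea_mul_of_flat hθ hs h hm]
    exact mul_le_mul_of_nonneg_left (integral_sliceProduct_le hs) (by positivity)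

lemma measurableSet_lowerBox {d : ℕ} (z : Fin d → ℝ) : MeasurableSet (lowerBox z) := by
  simp only [lowerBox, ofPred_forall]
  measurability

lemma measurableSet_lowerBox_graph (d : ℕ) :
    MeasurableSet {p : (Fin d → ℝ) × (Fin d → ℝ) | p.2 ∈ lowerBox p.1} := by
  have hset : {p : (Fin d → ℝ) × (Fin d → ℝ) | p.2 ∈ lowerBox p.1} =
      ⋂ i, ({p | 0 ≤ p.2 i} ∩ {p | p.2 i < p.1 i}) := by
    ext p
    simp [lowerBox]
  rw [hset]
  exact MeasurableSet.iInter fun i =>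
    (measurableSet_le (by fun_prop) (by fun_prop)).inter
      (measurableSet_lt (by fun_prop) (by fun_prop))

lemma measurable_measure_lowerBox {d : ℕ} (μ : Measure (Fin d → ℝ)) [SFinite μ] :
    Measurable fun z => μ (lowerBox z) :=
  measurable_measure_prodMk_left (measurableSet_lowerBox_graph d)

lemma volume_unitCube (d : ℕ) : volume (unitCube d) = 1 := by
  rw [unitCube, volume_pi_pi]
  simp

lemma measurableSet_unitCube (d : ℕ) : MeasurableSet (unitCube d) :=
  MeasurableSet.univ_pi fun _ => measurableSet_Icc

instance isFiniteMeasure_restrict_unitCube (d : ℕ) :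
    IsFiniteMeasure ((volume : Measure (Fin d → ℝ)).restrict (unitCube d)) :=
  ⟨by simp [volume_unitCube]⟩

lemma volume_lowerBox_toReal_mem {d : ℕ} {z : Fin d → ℝ} (hz : z ∈ unitCube d) :
    (volume (lowerBox z)).toReal ∈ Icc (0 : ℝ) 1 := by
  refine ⟨ENNReal.toReal_nonneg, ENNReal.toReal_le_of_le_ofReal zero_le_one ?_⟩
  rw [ENNReal.ofReal_one, ← volume_unitCube d]
  exact measure_mono fun y hy i _ => ⟨(hy i).1, (hy i).2.le.trans (hz i trivial).2⟩

lemma natCard_mem_eq_sum_indicator {ι α : Type} [Fintype ι] (P : ι → α) (B : Set α) :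
    (Nat.card {i // P i ∈ B} : ℝ) = ∑ i, B.indicator (fun _ => (1 : ℝ)) (P i) := by
  classical
  rw [Nat.card_eq_fintype_card, Fintype.card_subtype, Finset.card_filter]
  push_cast
  rfl

/-- Bias-variance decomposition for the relative frequency of a set in an independent sample. -/
lemma integral_sq_sub_frequency {ι α : Type} [Fintype ι] [MeasurableSpace α]
    (μ : ι → Measure α) [∀ i, IsProbabilityMeasure (μ i)] {B : Set α} (hB : MeasurableSet B)
    (v c : ℝ) :
    ∫ P, (v - c * ∑ i, B.indicator (fun _ => (1 : ℝ)) (P i)) ^ 2 ∂Measure.pi μ =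
      (v - c * ∑ i, (μ i).real B) ^ 2 + c ^ 2 * ∑ i, ((μ i).real B - (μ i).real B ^ 2) := by
  set f : α → ℝ := B.indicator fun _ => 1 with hf
  have hmeas : Measurable f := measurable_const.indicator hB
  have hbound (x : α) : ‖f x‖ ≤ 1 := by
    by_cases hx : x ∈ B <;> simp [hf, hx]
  have hLp (i : ι) : MemLp f 2 (μ i) :=
    MemLp.of_bound hmeas.aestronglyMeasurable 1 (.of_forall hbound)
  have hLpPi (i : ι) : MemLp (fun P : ι → α => f (P i)) 2 (Measure.pi μ) :=
    MemLp.of_bound (hmeas.comp (measurable_pi_apply i)).aestronglyMeasurable 1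
      (.of_forall fun P => hbound _)
  set S : (ι → α) → ℝ := ∑ i, fun P => f (P i) with hS
  have hSLp : MemLp S 2 (Measure.pi μ) := memLp_finsetSum' _ fun i _ => hLpPi i
  have hmean (i : ι) : ∫ x, f x ∂μ i = (μ i).real B := by
    rw [hf, integral_indicator_const _ hB]; simp
  have hmeanS : ∫ P, S P ∂Measure.pi μ = ∑ i, (μ i).real B := by
    simp only [hS, Finset.sum_apply]
    rw [integral_finsetSum _ fun i _ => (hLpPi i).integrable one_le_two]
    refine Finset.sum_congr rfl fun i _ => ?_
    rw [← hmean i]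
    conv_rhs => rw [← (measurePreserving_eval μ i).map_eq]
    rw [integral_map (measurable_pi_apply i).aemeasurable hmeas.aestronglyMeasurable]
  have hvar : ProbabilityTheory.variance S (Measure.pi μ)
      = ∑ i, ((μ i).real B - (μ i).real B ^ 2) := by
    rw [hS, ProbabilityTheory.variance_sum_pi hLp]
    refine Finset.sum_congr rfl fun i _ => ?_
    have hsq : f ^ 2 = f := by
      ext x
      by_cases hx : x ∈ B <;> simp [hf, hx]
    rw [ProbabilityTheory.variance_eq_sub (hLp i), hsq, hmean]
  have hsquare := ProbabilityTheory.variance_eq_sub hSLp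
  rw [hvar, hmeanS] at hsquare
  have hexpand (P : ι → α) : (v - c * ∑ i, f (P i)) ^ 2
      = v ^ 2 - 2 * v * c * S P + c ^ 2 * (S ^ 2) P := by
    simp only [hS, Finset.sum_apply, Pi.pow_apply]
    ring
  have hS1 := hSLp.integrable one_le_two
  have hS2 : Integrable (S ^ 2) (Measure.pi μ) := hSLp.integrable_sq
  simp_rw [hexpand]
  have hlin : Integrable (fun P => v ^ 2 - 2 * v * c * S P) (Measure.pi μ) :=
    (integrable_const _).sub (hS1.const_mul _)
  rw [integral_add hlin (hS2.const_mul _),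
    integral_sub (integrable_const _) (hS1.const_mul _), integral_const_mul, integral_const_mul,
    hmeanS]
  simp only [integral_const, probReal_univ, smul_eq_mul, one_mul]
  linear_combination (-c ^ 2) * hsquare

lemma integrable_sq_discrepancy {d : ℕ} {ι : Type} [Fintype ι]
    (μ : Measure (ι → Fin d → ℝ)) [IsFiniteMeasure μ] :
    Integrable (Function.uncurry fun (P : ι → Fin d → ℝ) z => ((volume (lowerBox z)).toReal
      - (Fintype.card ι : ℝ)⁻¹ * ∑ i, (lowerBox z).indicator (fun _ => (1 : ℝ)) (P i)) ^ 2)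
      (μ.prod (volume.restrict (unitCube d))) := by
  have hind (i : ι) : Measurable fun p : (ι → Fin d → ℝ) × (Fin d → ℝ) =>
      (lowerBox p.2).indicator (fun _ => (1 : ℝ)) (p.1 i) := by
    have hset : MeasurableSet {p : (ι → Fin d → ℝ) × (Fin d → ℝ) | p.1 i ∈ lowerBox p.2} :=
      (by fun_prop : Measurable fun p : (ι → Fin d → ℝ) × (Fin d → ℝ) => (p.2, p.1 i))
        (measurableSet_lowerBox_graph d)
    exact (measurable_const (a := (1 : ℝ))).indicator hset
  have hvol : Measurable fun p : (ι → Fin d → ℝ) × (Fin d → ℝ) =>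
      (volume (lowerBox p.2)).toReal :=
    ((measurable_measure_lowerBox volume).comp measurable_snd).ennreal_toReal
  refine Integrable.of_bound
    ((hvol.sub ((Finset.measurable_sum _ fun i _ => hind i).const_mul _)).pow_const
      2).aestronglyMeasurable 1 ?_
  have hcube : ∀ᵐ p ∂μ.prod (volume.restrict (unitCube d)), p.2 ∈ unitCube d :=
    Measure.quasiMeasurePreserving_snd.ae (ae_restrict_mem (measurableSet_unitCube d))
  filter_upwards [hcube] with p hp
  have hv := volume_lowerBox_toReal_mem hp
  have hnonneg (i : ι) : 0 ≤ (lowerBox p.2).indicator (fun _ => (1 : ℝ)) (p.1 i) :=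
    indicator_nonneg (fun _ _ => zero_le_one) _
  have hsum : ∑ i, (lowerBox p.2).indicator (fun _ => (1 : ℝ)) (p.1 i) ≤ Fintype.card ι := by
    refine (Finset.sum_le_card_nsmul _ _ 1 fun i _ =>
      indicator_le_self' (fun _ _ => zero_le_one) _).trans ?_
    simp
  have hlow := mul_nonneg (inv_nonneg.2 (Nat.cast_nonneg (α := ℝ) (Fintype.card ι)))
    (Finset.sum_nonneg fun i (_ : i ∈ Finset.univ) => hnonneg i)
  have hupp := (mul_le_mul_of_nonneg_left hsum
    (inv_nonneg.2 (Nat.cast_nonneg (α := ℝ) (Fintype.card ι)))).trans inv_mul_le_one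
  rw [Function.uncurry_def, Real.norm_of_nonneg (sq_nonneg _), sq_le_one_iff_abs_le_one, abs_le]
  constructor <;> linarith [hv.1, hv.2]

lemma expL2sq_eq_integral {d : ℕ} {ι : Type} [Fintype ι] (Ω : ι → Set (Fin d → ℝ))
    [∀ i, IsProbabilityMeasure (ProbabilityTheory.cond volume (Ω i))] :
    expL2sq Ω = ∫ z in unitCube d,
      (((volume (lowerBox z)).toReal - (Fintype.card ι : ℝ)⁻¹ *
          ∑ i, (ProbabilityTheory.cond volume (Ω i)).real (lowerBox z)) ^ 2 +
        (Fintype.card ι : ℝ)⁻¹ ^ 2 * ∑ i,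
          ((ProbabilityTheory.cond volume (Ω i)).real (lowerBox z) -
            (ProbabilityTheory.cond volume (Ω i)).real (lowerBox z) ^ 2)) := by
  simp only [expL2sq, L2sq, stratified, natCard_mem_eq_sum_indicator]
  rw [integral_integral_swap (integrable_sq_discrepancy _)]
  refine integral_congr_ae (.of_forall fun z => ?_)
  exact integral_sq_sub_frequency _ (measurableSet_lowerBox z) _ _

lemma integrableOn_unitCube_of_bounded {d : ℕ} {f : (Fin d → ℝ) → ℝ} (hf : Measurable f) (C : ℝ)
    (h : ∀ z ∈ unitCube d, |f z| ≤ C) : IntegrableOn f (unitCube d) :=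
  Integrable.of_bound hf.aestronglyMeasurable C
    ((ae_restrict_mem (measurableSet_unitCube d)).mono fun z hz => h z hz)

/-- If two stratifications differ in two cells only, and these cells have the same total mass in
every anchored box, then comparing the expected discrepancies amounts to comparing the integrals
of the products of the masses of these two cells. -/
lemma expL2sq_le_of_integral_mul_le {d : ℕ} {ι : Type} [Fintype ι]
    (Ω Ω' : ι → Set (Fin d → ℝ))
    [∀ i, IsProbabilityMeasure (ProbabilityTheory.cond volume (Ω i))]
    [∀ i, IsProbabilityMeasure (ProbabilityTheory.cond volume (Ω' i))]
    {a b : ι} (hab : a ≠ b) (hother : ∀ i, i ≠ a ∧ i ≠ b → Ω i = Ω' i)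
    (hsum : ∀ z ∈ unitCube d,
      (ProbabilityTheory.cond volume (Ω a)).real (lowerBox z) +
          (ProbabilityTheory.cond volume (Ω b)).real (lowerBox z) =
        (ProbabilityTheory.cond volume (Ω' a)).real (lowerBox z) +
          (ProbabilityTheory.cond volume (Ω' b)).real (lowerBox z))
    (hmul : ∫ z in unitCube d, (ProbabilityTheory.cond volume (Ω a)).real (lowerBox z) *
          (ProbabilityTheory.cond volume (Ω b)).real (lowerBox z) ≤
        ∫ z in unitCube d, (ProbabilityTheory.cond volume (Ω' a)).real (lowerBox z) *
          (ProbabilityTheory.cond volume (Ω' b)).real (lowerBox z)) :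
    expL2sq Ω ≤ expL2sq Ω' := by
  rw [expL2sq_eq_integral, expL2sq_eq_integral]
  set q : ι → (Fin d → ℝ) → ℝ :=
    fun i z => (ProbabilityTheory.cond volume (Ω i)).real (lowerBox z) with hq
  set q' : ι → (Fin d → ℝ) → ℝ :=
    fun i z => (ProbabilityTheory.cond volume (Ω' i)).real (lowerBox z) with hq'
  have hmeas (i : ι) : Measurable (q i) := (measurable_measure_lowerBox _).ennreal_toReal
  have hmeas' (i : ι) : Measurable (q' i) := (measurable_measure_lowerBox _).ennreal_toReal
  have hint : IntegrableOn (fun z => q a z * q b z) (unitCube d) := by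
    refine integrableOn_unitCube_of_bounded ((hmeas a).mul (hmeas b)) 1 fun z _ => ?_
    rw [abs_of_nonneg (mul_nonneg measureReal_nonneg measureReal_nonneg)]
    exact mul_le_one₀ measureReal_le_one measureReal_nonneg measureReal_le_one
  have hint' : IntegrableOn (fun z => q' a z * q' b z) (unitCube d) := by
    refine integrableOn_unitCube_of_bounded ((hmeas' a).mul (hmeas' b)) 1 fun z _ => ?_
    rw [abs_of_nonneg (mul_nonneg measureReal_nonneg measureReal_nonneg)]
    exact mul_le_one₀ measureReal_le_one measureReal_nonneg measureReal_le_one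
  set c : ℝ := (Fintype.card ι : ℝ)⁻¹ with hc
  have htotal {z : Fin d → ℝ} (hz : z ∈ unitCube d) : ∑ i, q i z = ∑ i, q' i z := by
    rw [← sub_eq_zero, ← Finset.sum_sub_distrib, Finset.sum_eq_add a b hab]
    · linarith [hsum z hz]
    · intro i _ hi
      simp [hq, hq', hother i hi]
    · simp
    · simp
  have hsquares {z : Fin d → ℝ} (hz : z ∈ unitCube d) :
      ∑ i, (q i z - q i z ^ 2) =
        ∑ i, (q' i z - q' i z ^ 2) + 2 * (q a z * q b z - q' a z * q' b z) := by
    rw [← sub_eq_iff_eq_add', ← Finset.sum_sub_distrib, Finset.sum_eq_add a b hab]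
    · have h := hsum z hz
      change q a z + q b z = q' a z + q' b z at h
      linear_combination (1 - q a z - q b z - q' a z - q' b z) * h
    · intro i _ hi
      simp [hq, hq', hother i hi]
    · simp
    · simp
  have hintegrand : ∀ᵐ z ∂volume.restrict (unitCube d),
      ((volume (lowerBox z)).toReal - c * ∑ i, q i z) ^ 2 + c ^ 2 * ∑ i, (q i z - q i z ^ 2) =
        (((volume (lowerBox z)).toReal - c * ∑ i, q' i z) ^ 2
          + c ^ 2 * ∑ i, (q' i z - q' i z ^ 2))
          + 2 * c ^ 2 * (q a z * q b z - q' a z * q' b z) := by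
    filter_upwards [ae_restrict_mem (measurableSet_unitCube d)] with z hz
    rw [htotal hz, hsquares hz]
    ring
  have hrest : IntegrableOn (fun z => ((volume (lowerBox z)).toReal - c * ∑ i, q' i z) ^ 2
      + c ^ 2 * ∑ i, (q' i z - q' i z ^ 2)) (unitCube d) := by
    have hswap := (integrable_sq_discrepancy
      (Measure.pi fun i => ProbabilityTheory.cond volume (Ω' i))).integral_prod_right
    refine hswap.congr (.of_forall fun z => ?_)
    exact integral_sq_sub_frequency (fun i => ProbabilityTheory.cond volume (Ω' i))
      (measurableSet_lowerBox z) (volume (lowerBox z)).toReal c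
  have hdiff : IntegrableOn (fun z => 2 * c ^ 2 * (q a z * q b z - q' a z * q' b z)) (unitCube d) :=
    (hint.sub hint').const_mul _
  rw [integral_congr_ae hintegrand, integral_add hrest hdiff,
    integral_const_mul, integral_sub hint hint']
  have := mul_nonneg (by positivity : (0 : ℝ) ≤ 2 * c ^ 2) (sub_nonneg.2 hmul)
  linarith

/-- Splitting off the first two coordinates. -/
def splitFirstTwo (n : ℕ) : (Fin (n + 2) → ℝ) ≃ᵐ (ℝ × ℝ) × (Fin n → ℝ) :=
  ((MeasurableEquiv.piFinSuccAbove (fun _ => ℝ) 0).trans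
    ((MeasurableEquiv.refl ℝ).prodCongr (MeasurableEquiv.piFinSuccAbove (fun _ => ℝ) 0))).trans
      MeasurableEquiv.prodAssoc.symm

lemma splitFirstTwo_apply {n : ℕ} (x : Fin (n + 2) → ℝ) :
    splitFirstTwo n x = ((x 0, x 1), fun j => x j.succ.succ) := rfl

lemma measurePreserving_splitFirstTwo (n : ℕ) :
    MeasurePreserving (splitFirstTwo n) volume volume := by
  have h1 := volume_preserving_piFinSuccAbove (fun _ : Fin (n + 2) => ℝ) 0
  have h2 := (MeasurePreserving.id (volume : Measure ℝ)).prod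
    (volume_preserving_piFinSuccAbove (fun _ : Fin (n + 1) => ℝ) 0)
  have h3 := (volume_preserving_prodAssoc (α₁ := ℝ) (β₁ := ℝ) (γ₁ := Fin n → ℝ)).symm
  exact (h3.comp h2).comp h1

lemma volume_real_splitFirstTwo_preimage {n : ℕ} {A : Set (ℝ × ℝ)} (C : Fin n → Set ℝ) :
    volume.real (splitFirstTwo n ⁻¹' (A ×ˢ univ.pi C)) =
      volume.real A * ∏ j, volume.real (C j) := by
  rw [Measure.real, (measurePreserving_splitFirstTwo n).measure_preimage_equiv,
    Measure.volume_eq_prod, Measure.prod_prod, volume_pi_pi, ENNReal.toReal_mul,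
    ENNReal.toReal_prod]
  rfl

open scoped Pointwise in
lemma volume_real_image_affine {d : ℕ} (a : Fin d → ℝ) {m : ℝ} (hm : 0 < m)
    (S : Set (Fin d → ℝ)) :
    volume.real ((fun x : Fin d → ℝ => fun j => a j + x j / m) '' S) =
      (m⁻¹) ^ d * volume.real S := by
  have himage : (fun x : Fin d → ℝ => fun j => a j + x j / m) '' S =
      (fun x => a + x) '' (m⁻¹ • S) := by
    rw [← image_smul, image_image]
    refine image_congr fun x _ => ?_
    ext j
    simp [div_eq_inv_mul]
  rw [himage, image_add_left, Measure.real, measure_preimage_add, Measure.addHaar_smul,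
    ENNReal.toReal_mul, Module.finrank_fin_fun, ENNReal.toReal_ofReal (abs_nonneg _),
    abs_of_nonneg (by positivity)]
  rfl

lemma cond_image_affine_real {d : ℕ} (a : Fin d → ℝ) {m : ℝ} (hm : 0 < m)
    (S : Set (Fin d → ℝ)) {B : Set (Fin d → ℝ)} (hB : MeasurableSet B) :
    (ProbabilityTheory.cond volume
        ((fun x : Fin d → ℝ => fun j => a j + x j / m) '' S)).real B =
      (volume.real S)⁻¹ *
        volume.real (S ∩ (fun x : Fin d → ℝ => fun j => a j + x j / m) ⁻¹' B) := by
  rw [Measure.real, ProbabilityTheory.cond_apply' hB, ENNReal.toReal_mul, ENNReal.toReal_inv,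
    ← image_inter_preimage]
  change (volume.real _)⁻¹ * volume.real _ = _
  rw [volume_real_image_affine a hm, volume_real_image_affine a hm]
  have : (m⁻¹) ^ d ≠ 0 := by positivity
  rw [mul_inv]
  field_simp

lemma cornerCell_eq {n m : ℕ} (hd : 2 ≤ n + 2) (θ : ℝ) (i : Fin 2) :
    cornerCell m (n + 2) hd θ i =
      (fun x : Fin (n + 2) → ℝ => fun j => anchor m (n + 2) j + x j / m) ''
      (splitFirstTwo n ⁻¹' (planeCell θ i ×ˢ univ.pi fun _ => Icc 0 1)) := by
  unfold cornerCell
  congr 1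
  ext x
  simp only [mem_ofPred_eq, mem_preimage, splitFirstTwo_apply, mem_prod, mem_univ_pi]
  refine and_congr Iff.rfl ?_
  rw [Fin.forall_fin_succ, Fin.forall_fin_succ]
  simp

lemma volume_real_cornerCell_preimage {n : ℕ} {θ : ℝ} (hθ : θ ∈ Icc 0 (π / 2)) (i : Fin 2) :
    volume.real (splitFirstTwo n ⁻¹' (planeCell θ i ×ˢ univ.pi fun _ => Icc 0 1)) = 1 := by
  rw [volume_real_splitFirstTwo_preimage, volume_real_planeCell hθ]
  simp

/-- The contribution of the last `n` coordinates to the mass of a corner cell in a box. -/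
def tailFactor {n : ℕ} (m : ℝ) (r : Fin n → ℝ) : ℝ :=
  ∏ j, volume.real (Icc (0 : ℝ) 1 ∩ Iio (m * r j - (m - 1)))

lemma cond_cornerCell_lowerBox {n m : ℕ} (hd : 2 ≤ n + 2) (hm : 2 ≤ m) {θ : ℝ}
    (hθ : θ ∈ Icc 0 (π / 2)) (i : Fin 2) (z : Fin (n + 2) → ℝ) :
    (ProbabilityTheory.cond volume (cornerCell m (n + 2) hd θ i)).real (lowerBox z) =
      cellArea θ i (cornerCoord m (z 0, z 1)) * tailFactor m fun j : Fin n => z j.succ.succ := by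
  have hm2 : (2 : ℝ) ≤ m := by exact_mod_cast hm
  have hm0 : (0 : ℝ) < m := by linarith
  rw [cornerCell_eq, cond_image_affine_real _ hm0 _ (measurableSet_lowerBox z),
    volume_real_cornerCell_preimage hθ, inv_one, one_mul, cellArea, tailFactor,
    ← volume_real_splitFirstTwo_preimage]
  congr 1
  have hbox {a x c y : ℝ} (ha : a = (m - c) / m) (hc : c ≤ m) (hx : 0 ≤ x) :
      (0 ≤ a + x / m ∧ a + x / m < y) ↔ x < m * y - (m - c) := by
    have hrw : a + x / m = (m - c + x) / m := by rw [ha]; ring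
    rw [hrw, div_lt_iff₀ hm0, and_iff_right (div_nonneg (by linarith) hm0.le)]
    constructor <;> intro h <;> linarith
  ext x
  simp only [mem_inter_iff, mem_preimage, splitFirstTwo_apply, mem_prod, mem_univ_pi, lowerBox,
    mem_ofPred_eq, quadrant, cornerCoord, mem_Iio]
  rw [Fin.forall_fin_succ, Fin.forall_fin_succ]
  constructor
  · rintro ⟨⟨hA, hC⟩, h0, h1, hj⟩
    have hI := planeCell_subset_I2 hθ i hA
    refine ⟨⟨hA, (hbox (by simp [anchor]) hm2 hI.1.1).1 h0,
      (hbox (by simp [anchor]) (by linarith) hI.2.1).1 h1⟩, fun j => ⟨hC j, ?_⟩⟩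
    exact (hbox (by simp [anchor]) (by linarith) (hC j).1).1 (hj j)
  · rintro ⟨⟨hA, h0, h1⟩, hC⟩
    have hI := planeCell_subset_I2 hθ i hA
    refine ⟨⟨hA, fun j => (hC j).1⟩, (hbox (by simp [anchor]) hm2 hI.1.1).2 h0,
      (hbox (by simp [anchor]) (by linarith) hI.2.1).2 h1, fun j => ?_⟩
    exact (hbox (by simp [anchor]) (by linarith) (hC j).1.1).2 (hC j).2

lemma unitCube_eq_preimage (n : ℕ) :
    unitCube (n + 2) = splitFirstTwo n ⁻¹' ((Icc 0 1 ×ˢ Icc 0 1) ×ˢ unitCube n) := by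
  ext x
  simp only [unitCube, mem_preimage, splitFirstTwo_apply, mem_prod, mem_univ_pi]
  rw [Fin.forall_fin_succ, Fin.forall_fin_succ, and_assoc]
  rfl

lemma integral_cond_cornerCell_mul {n m : ℕ} (hd : 2 ≤ n + 2) (hm : 2 ≤ m) {θ : ℝ}
    (hθ : θ ∈ Icc 0 (π / 2)) :
    ∫ z in unitCube (n + 2),
      (ProbabilityTheory.cond volume (cornerCell m (n + 2) hd θ 0)).real (lowerBox z) *
        (ProbabilityTheory.cond volume (cornerCell m (n + 2) hd θ 1)).real (lowerBox z) =
      (∫ z in Icc (0 : ℝ) 1 ×ˢ Icc (0 : ℝ) 1,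
        cellArea θ 0 (cornerCoord m z) * cellArea θ 1 (cornerCoord m z)) *
        ∫ r in unitCube n, tailFactor m r ^ 2 := by
  have hsplit := (measurePreserving_splitFirstTwo n).setIntegral_preimage_emb
    (splitFirstTwo n).measurableEmbedding
    (fun p => cellArea θ 0 (cornerCoord m p.1) * cellArea θ 1 (cornerCoord m p.1) *
      tailFactor m p.2 ^ 2) ((Icc 0 1 ×ˢ Icc 0 1) ×ˢ unitCube n)
  have hprod := setIntegral_prod_mul (μ := (volume : Measure (ℝ × ℝ)))
    (ν := (volume : Measure (Fin n → ℝ)))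
    (fun z => cellArea θ 0 (cornerCoord m z) * cellArea θ 1 (cornerCoord m z))
    (fun r => tailFactor m r ^ 2) (Icc 0 1 ×ˢ Icc 0 1) (unitCube n)
  rw [← unitCube_eq_preimage] at hsplit
  rw [← hprod]
  refine Eq.trans ?_ hsplit
  refine integral_congr_ae (.of_forall fun z => ?_)
  simp only [cond_cornerCell_lowerBox hd hm hθ, splitFirstTwo_apply]
  ring

lemma volume_real_gridCell_pos {d m : ℕ} (hm : 0 < m) (k : Fin d → Fin m) :
    0 < volume.real (gridCell m k) := by
  have hm0 : (0 : ℝ) < m := by exact_mod_cast hm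
  rw [gridCell, Measure.real, volume_pi_pi, ENNReal.toReal_prod]
  refine Finset.prod_pos fun j _ => ?_
  have hlen : ((k j : ℝ) + 1) / m - (k j : ℝ) / m = 1 / m := by ring
  rw [Real.volume_Ico, hlen, ENNReal.toReal_ofReal (by positivity)]
  positivity

lemma isProbabilityMeasure_cond_of_real_pos {α : Type} [MeasurableSpace α] {μ : Measure α}
    {s : Set α} (hs : 0 < μ.real s) : IsProbabilityMeasure (ProbabilityTheory.cond μ s) := by
  have h := ENNReal.toReal_pos_iff.1 hs
  exact ProbabilityTheory.cond_isProbabilityMeasure_of_finite h.1.ne' h.2.ne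

lemma isProbabilityMeasure_cond_OmegaStarSim {n m : ℕ} (hd : 2 ≤ n + 2) (hm : 2 ≤ m) {θ : ℝ}
    (hθ : θ ∈ Icc 0 (π / 2)) (k : Fin (n + 2) → Fin m) :
    IsProbabilityMeasure (ProbabilityTheory.cond volume (OmegaStarSim m (n + 2) hd θ k)) := by
  have hm0 : (0 : ℝ) < m := by exact_mod_cast (by omega : 0 < m)
  have hcorner (i : Fin 2) : 0 < volume.real (cornerCell m (n + 2) hd θ i) := by
    rw [cornerCell_eq, volume_real_image_affine _ hm0, volume_real_cornerCell_preimage hθ]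
    positivity
  refine isProbabilityMeasure_cond_of_real_pos ?_
  unfold OmegaStarSim
  split_ifs
  · exact hcorner 0
  · exact hcorner 1
  · exact volume_real_gridCell_pos (by omega) k

end

/-- For integers `m ≥ d ≥ 2`, `N = m^d`, and `θ ∈ [0, π/2]`, the expected
squared `L₂`-discrepancy of the stratified sample from `Ω*∼(θ)` is at most that of the
stratified (jittered) sample from the grid partition `Ω*_| = Ω*∼(π/2)`. -/
theorem expL2sq_OmegaStarSim_le_jittered (m d : ℕ) (hd : 2 ≤ d) (hm : d ≤ m)
    (θ : ℝ) (hθ : θ ∈ Set.Icc 0 (π / 2)) :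
    expL2sq (OmegaStarSim m d hd θ) ≤ expL2sq (OmegaStarSim m d hd (π / 2)) := by
  obtain ⟨n, rfl⟩ : ∃ n, d = n + 2 := ⟨d - 2, by omega⟩
  have hm2 : 2 ≤ m := hd.trans hm
  have hpi : π / 2 ∈ Icc 0 (π / 2) := ⟨by positivity, le_rfl⟩
  have := isProbabilityMeasure_cond_OmegaStarSim hd hm2 hθ
  have := isProbabilityMeasure_cond_OmegaStarSim hd hm2 hpi
  set a : Fin (n + 2) → Fin m :=
    fun j => ⟨if (j : ℕ) = 0 then m - 2 else m - 1, by split_ifs <;> omega⟩ with ha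
  set b : Fin (n + 2) → Fin m := fun _ => ⟨m - 1, by omega⟩ with hb
  have hfirst (φ : ℝ) : OmegaStarSim m (n + 2) hd φ a = cornerCell m (n + 2) hd φ 0 := by
    rw [OmegaStarSim, if_pos fun _ => rfl]
  have hab : a ≠ b := fun h => by
    have := congrArg Fin.val (congrFun h 0)
    simp only [ha, hb, Fin.val_zero, if_true] at this
    omega
  have hcorner_iff (k : Fin (n + 2) → Fin m) :
      (∀ j, (k j : ℕ) = if (j : ℕ) = 0 then m - 2 else m - 1) ↔ k = a :=
    ⟨fun h => funext fun j => Fin.ext (h j), fun h j => by rw [h]⟩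
  have htop_iff (k : Fin (n + 2) → Fin m) : (∀ j, (k j : ℕ) = m - 1) ↔ k = b :=
    ⟨fun h => funext fun j => Fin.ext (h j), fun h j => by rw [h]⟩
  have hsecond (φ : ℝ) : OmegaStarSim m (n + 2) hd φ b = cornerCell m (n + 2) hd φ 1 := by
    rw [OmegaStarSim, if_neg (by rw [hcorner_iff]; exact hab.symm), if_pos fun _ => rfl]
  refine expL2sq_le_of_integral_mul_le _ _ hab (fun k hk => ?_) (fun z _ => ?_) ?_
  · simp only [OmegaStarSim, hcorner_iff, htop_iff, if_neg hk.1, if_neg hk.2]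
  · simp only [hfirst, hsecond, cond_cornerCell_lowerBox hd hm2 hθ,
      cond_cornerCell_lowerBox hd hm2 hpi, ← add_mul, cellArea_add hθ, cellArea_add hpi]
  · simp only [hfirst, hsecond]
    rw [integral_cond_cornerCell_mul hd hm2 hθ, integral_cond_cornerCell_mul hd hm2 hpi]
    exact mul_le_mul_of_nonneg_right (integral_cellArea_mul_le hθ (by exact_mod_cast hm2))
      (integral_nonneg fun r => sq_nonneg _)
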